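/- Let 𝔣 be of bounded variation with ∫_𝕋 𝔣(x) dx = 0, and let 𝔭(x) = e^{𝔣(x)}/(1+e^{𝔣(x)}). Then M(n) → +∞ as n → +∞ and M(n) → −∞ as n → −∞, uniformly in x ∈ 𝕋 (i.e., for every A > 0 there is n₀, independent of x, with M(n) > A for n ≥ n₀ and M(n) < −A for n ≤ −n₀). Consequently, for every x ∈ 𝕋 the random walk (ξ_n) in the environment (𝔭, α, x) is recurrent: it returns to 0 ℙ_x-almost surely. -/

import Mathlib

open MeasureTheory Filter Finset

noncomputable section

attribute [local instance] Classical.propDecidable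

/-- The point `x + j·α` on the circle `𝕋 = ℝ/ℤ`. -/
def pt (α : ℝ) (x : UnitAddCircle) (j : ℤ) : UnitAddCircle :=
  x + (((j : ℝ) * α : ℝ) : UnitAddCircle)

/-- One-step transition probability of the random walk on `ℤ` in the quasi-periodic
environment `(𝔭, α, x)`: from `j` it jumps to `j+1` with probability `𝔭(x+jα)` and to
`j-1` with probability `𝔮(x+jα) = 1-𝔭(x+jα)`. -/
def stepProb (𝔭 : UnitAddCircle → ℝ) (α : ℝ) (x : UnitAddCircle) (j j' : ℤ) : ℝ :=
  if j' = j + 1 then 𝔭 (pt α x j) else if j' = j - 1 then 1 - 𝔭 (pt α x j) else 0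

/-- `ξ` is (a version of) the random walk on `ℤ` in the quasi-periodic environment
`(𝔭, α, x)` started at `start`, defined on the probability space `(Ω, ℙ)`; this is
expressed through its finite-dimensional distributions. -/
def IsQPWalk (𝔭 : UnitAddCircle → ℝ) (α : ℝ) (x : UnitAddCircle) (start : ℤ)
    {Ω : Type} [MeasurableSpace Ω] (ℙ : Measure Ω) (ξ : ℕ → Ω → ℤ) : Prop :=
  IsProbabilityMeasure ℙ ∧ (∀ n, Measurable (ξ n)) ∧
  ∀ (n : ℕ) (k : ℕ → ℤ),
    ℙ {ω | ∀ i ≤ n, ξ i ω = k i} =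
      ENNReal.ofReal ((if k 0 = start then (1 : ℝ) else 0) *
        ∏ i ∈ Finset.range n, stepProb 𝔭 α x (k i) (k (i + 1)))

/-- `𝔣` is continuous, of bounded variation, with `∫_𝕋 𝔣(z) dz = 0`. -/
def ZeroMeanBV (𝔣 : UnitAddCircle → ℝ) : Prop :=
  Continuous 𝔣 ∧ BoundedVariationOn (fun t : ℝ => 𝔣 (t : UnitAddCircle)) (Set.Icc 0 1) ∧
    ∫ z : UnitAddCircle, 𝔣 z = 0

/-- The function `𝔭 = e^𝔣/(1+e^𝔣)` associated to `𝔣`. -/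
def pOf (𝔣 : UnitAddCircle → ℝ) : UnitAddCircle → ℝ :=
  fun z => Real.exp (𝔣 z) / (1 + Real.exp (𝔣 z))

/-- The function `M : ℤ → ℝ` (depending on `(𝔭, α, x)`): `M(0) = 0`, `M(1) = 1`,
`M(n) = 1 + Σ_{k=1}^{n-1} Π_{j=1}^{k} 𝔮(x+jα)/𝔭(x+jα)` for `n ≥ 2`, and
`M(-n) = - Σ_{k=0}^{n} Π_{j=0}^{k} 𝔭(x-jα)/𝔮(x-jα)` for `n ≥ 1`. -/
def Mfun (𝔭 : UnitAddCircle → ℝ) (α : ℝ) (x : UnitAddCircle) (n : ℤ) : ℝ :=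
  if 1 ≤ n then
    1 + ∑ k ∈ Finset.Icc 1 (n.toNat - 1), ∏ j ∈ Finset.Icc 1 k,
      (1 - 𝔭 (pt α x (j : ℤ))) / 𝔭 (pt α x (j : ℤ))
  else if n = 0 then 0
  else
    -∑ k ∈ Finset.range ((-n).toNat + 1), ∏ j ∈ Finset.range (k + 1),
      𝔭 (pt α x (-(j : ℤ))) / (1 - 𝔭 (pt α x (-(j : ℤ))))


lemma dk_den (α : ℝ) (hα : Irrational α) (N : ℕ) :
    ∃ r : ℚ, N ≤ r.den ∧ |α - r| < 1 / (r.den : ℝ) ^ 2 := by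
  by_contra! h
  have hinf := Real.infinite_rat_abs_sub_lt_one_div_den_sq_of_irrational hα
  apply hinf
  set K : ℤ := ⌈(|α| + 1) * N⌉ with hK
  refine Set.Finite.subset (((Set.finite_Icc (-K) K).prod (Set.finite_Iio N)).image
    (fun ab : ℤ × ℕ => (ab.1 : ℚ) / (ab.2 : ℚ))) ?_
  intro r hr
  have hr' : |α - r| < 1 / (r.den : ℝ) ^ 2 := hr
  have hN : r.den < N := by
    by_contra! h'
    exact absurd hr' (not_lt.mpr (h r h'))
  refine ⟨(r.num, r.den), ⟨?_, hN⟩, Rat.num_div_den r⟩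
  have hd : (1:ℝ) ≤ r.den := by exact_mod_cast r.pos
  have h1 : 1 / (r.den : ℝ) ^ 2 ≤ 1 := by
    rw [div_le_one (by positivity)]; nlinarith
  have h2 : |(r:ℝ)| ≤ |α| + 1 := by
    have := abs_sub_abs_le_abs_sub (r:ℝ) α
    rw [abs_sub_comm] at this
    linarith
  have h3 : (r.num : ℝ) = r * r.den := by exact_mod_cast (Rat.mul_den_eq_num r).symm
  have h4 : |(r.num : ℝ)| ≤ (|α| + 1) * N := by
    rw [h3, abs_mul, abs_of_pos (by linarith : (0:ℝ) < r.den)]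
    apply mul_le_mul h2 (by exact_mod_cast hN.le) (by linarith) (by positivity)
  have h5 : |(r.num : ℝ)| ≤ K := h4.trans (Int.le_ceil _)
  have h6 : |r.num| ≤ K := by exact_mod_cast h5
  exact abs_le.mp h6

lemma dk_bv (F : ℝ → ℝ) (hper : ∀ t, F (t + 1) = F t) (h : BoundedVariationOn F (Set.Icc 0 1)) :
    BoundedVariationOn F (Set.Icc (-1) 2) := by
  have e1 : F ∘ (fun t => t + 1) = F := funext hper
  have hm : Monotone (fun t : ℝ => t + 1) := fun a b h => by simpa using h
  have h2 : eVariationOn F (Set.Icc 1 2) = eVariationOn F (Set.Icc 0 1) := by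
    conv_rhs => rw [← e1, eVariationOn.comp_eq_of_monotoneOn F _ (hm.monotoneOn _)]
    simp; norm_num
  have h3 : eVariationOn F (Set.Icc (-1) 0) = eVariationOn F (Set.Icc 0 1) := by
    conv_lhs => rw [← e1, eVariationOn.comp_eq_of_monotoneOn F _ (hm.monotoneOn _)]
    simp
  have a1 := eVariationOn.Icc_add_Icc F (s := Set.univ) (a := -1) (b := 0) (c := 1)
    (by norm_num) (by norm_num) trivial
  have a2 := eVariationOn.Icc_add_Icc F (s := Set.univ) (a := -1) (b := 1) (c := 2)
    (by norm_num) (by norm_num) trivial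
  simp only [Set.univ_inter] at a1 a2
  unfold BoundedVariationOn at *
  rw [← a2, ← a1, h2, h3]
  simp [h]

lemma dk_core (F g h : ℝ → ℝ) (hper : ∀ t, ∀ n : ℤ, F (t + n) = F t)
    (hg : MonotoneOn g (Set.Icc (-1) 2)) (hh : MonotoneOn h (Set.Icc (-1) 2))
    (hF : F = g - h) (hint : ∀ t, ∫ s in t..t+1, F s = 0) (α : ℝ) (r : ℚ)
    (hr : |α - r| < 1 / (r.den : ℝ) ^ 2) (x : ℝ) (hx0 : 0 ≤ x) (hx1 : x ≤ 1) :
    |∑ j ∈ range r.den, F (x + j * α)| ≤ 2 * ((g 2 + h 2) - (g (-1) + h (-1))) := by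
  set q : ℕ := r.den with hq
  have hq0 : 0 < q := r.pos
  have hqR : (0:ℝ) < q := by exact_mod_cast hq0
  set v : ℝ → ℝ := fun t => g t + h t with hv
  have hvm : ∀ s ∈ Set.Icc (-1:ℝ) 2, ∀ t ∈ Set.Icc (-1:ℝ) 2, s ≤ t → v s ≤ v t :=
    fun s hs t ht hst => add_le_add (hg hs ht hst) (hh hs ht hst)
  -- oscillation
  have hosc : ∀ a b s t, -1 ≤ a → b ≤ 2 → s ∈ Set.Icc a b → t ∈ Set.Icc a b →
      |F s - F t| ≤ v b - v a := by
    intro a b s t ha hb hs ht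
    have ms : s ∈ Set.Icc (-1:ℝ) 2 := ⟨ha.trans hs.1, hs.2.trans hb⟩
    have mt : t ∈ Set.Icc (-1:ℝ) 2 := ⟨ha.trans ht.1, ht.2.trans hb⟩
    have hab : a ≤ b := hs.1.trans hs.2
    have ma : a ∈ Set.Icc (-1:ℝ) 2 := ⟨ha, hab.trans hb⟩
    have mb : b ∈ Set.Icc (-1:ℝ) 2 := ⟨ha.trans hab, hb⟩
    have g1 := hg ma ms hs.1
    have g2 := hg ms mb hs.2
    have g3 := hg ma mt ht.1
    have g4 := hg mt mb ht.2
    have h1 := hh ma ms hs.1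
    have h2 := hh ms mb hs.2
    have h3 := hh ma mt ht.1
    have h4 := hh mt mb ht.2
    simp only [hF, hv, Pi.sub_apply]
    rw [abs_le]; constructor <;> linarith
  have hii : ∀ a b, -1 ≤ a → a ≤ b → b ≤ 2 → IntervalIntegrable F volume a b := by
    intro a b ha hab hb
    have hsub : Set.uIcc a b ⊆ Set.Icc (-1) 2 := by
      rw [Set.uIcc_of_le hab]; exact Set.Icc_subset_Icc ha hb
    rw [hF]
    exact (hg.mono hsub).intervalIntegrable.sub (hh.mono hsub).intervalIntegrable
  -- grid
  set b : ℕ → ℝ := fun i => x + ((i:ℝ) - 1) / q with hb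
  have hbs : ∀ i, b (i+1) - b i = 1 / q := by
    intro i; simp only [hb]; push_cast; field_simp; ring
  have hbm : Monotone b := by
    apply monotone_nat_of_le_succ
    intro i
    have := hbs i
    have : (0:ℝ) < 1 / q := by positivity
    linarith
  have hq1 : (1:ℝ) ≤ q := by exact_mod_cast hq0
  have hb0 : -1 ≤ b 0 := by
    have : 1 / (q:ℝ) ≤ 1 := by rw [div_le_one hqR]; exact hq1
    simp only [hb]; push_cast
    have e : ((0:ℝ) - 1) / q = - (1 / q) := by ring
    rw [e]; linarith
  have hbq : b (q+1) = x + 1 := by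
    simp only [hb]; push_cast; field_simp; ring
  have hb1 : b 1 = x := by simp [hb]
  have hlo : ∀ i, -1 ≤ b i := fun i => hb0.trans (hbm (Nat.zero_le i))
  have hhi : ∀ i, i ≤ q + 1 → b i ≤ 2 := fun i hi => (hbm hi).trans (by rw [hbq]; linarith)
  -- index map
  set σ : ℕ → ℕ := fun j => ((j * r.num) % (q:ℤ)).toNat with hσ
  have hσc : ∀ j, ((σ j : ℕ) : ℤ) = (j * r.num) % (q:ℤ) := fun j =>
    Int.toNat_of_nonneg (Int.emod_nonneg _ (by exact_mod_cast hq0.ne'))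
  have hσlt : ∀ j, σ j < q := by
    intro j
    have := Int.emod_lt_of_pos (j * r.num) (b := (q:ℤ)) (by exact_mod_cast hq0)
    rw [← hσc] at this
    exact_mod_cast this
  have hmaps : Set.MapsTo σ (range q : Finset ℕ) (range q : Finset ℕ) := by
    intro j _; simpa using hσlt j
  have hinj : Set.InjOn σ (range q : Finset ℕ) := by
    intro i hi j hj hij
    simp only [coe_range, Set.mem_Iio] at hi hj
    have h1 : (i * r.num) % (q:ℤ) = (j * r.num) % (q:ℤ) := by
      rw [← hσc, ← hσc, hij]
    have h2 : (q:ℤ) ∣ i * r.num - j * r.num :=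
      Int.ModEq.dvd (show (j * r.num : ℤ) ≡ i * r.num [ZMOD q] from h1.symm)
    rw [← sub_mul] at h2
    have hc : IsCoprime (q:ℤ) r.num := by
      rw [Int.isCoprime_iff_gcd_eq_one, Int.gcd_comm]
      simpa [Int.gcd] using r.reduced
    have h3 := hc.dvd_of_dvd_mul_right h2
    have h4 : (i:ℤ) - j = 0 := by
      apply Int.eq_zero_of_abs_lt_dvd h3
      rw [abs_lt]; constructor <;> omega
    omega
  have hsurj : Set.SurjOn σ (range q : Finset ℕ) (range q : Finset ℕ) :=
    Finset.surjOn_of_injOn_of_card_le σ hmaps hinj le_rfl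
  have hreidx : ∀ φ : ℕ → ℝ, ∑ j ∈ range q, φ (σ j) = ∑ i ∈ range q, φ i := fun φ =>
    Finset.sum_nbij σ hmaps hinj hsurj (fun _ _ => rfl)
  -- main estimate
  have hmain : ∀ j ∈ range q, |F (x + j * α) - q * ∫ s in b (σ j + 1)..b (σ j + 1 + 1), F s| ≤
      v (b (σ j + 1 + 1)) - v (b (σ j)) := by
    intro j hj
    have hjq : j < q := by simpa using hj
    set i := σ j with hi
    have hiq : i < q := hσlt j
    set t := b (i+1) + j * (α - r) with ht
    have hd : |(j:ℝ) * (α - r)| ≤ 1 / q := by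
      rw [abs_mul, Nat.abs_cast]
      have h1 : (j:ℝ) ≤ q := by exact_mod_cast hjq.le
      calc (j:ℝ) * |α - r| ≤ q * (1 / (q:ℝ)^2) :=
            mul_le_mul h1 hr.le (abs_nonneg _) hqR.le
        _ = 1 / q := by field_simp
    have hFt : F (x + j * α) = F t := by
      have h1 : (j * r.num : ℤ) = q * ((j * r.num) / (q:ℤ)) + i := by
        rw [hi, hσc]; exact (Int.mul_ediv_add_emod _ _).symm
      set m := (j * r.num) / (q:ℤ) with hm
      have h2 : (j:ℝ) * r.num = q * m + i := by exact_mod_cast h1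
      have h3 : (r:ℝ) = r.num / q := by
        have := Rat.num_div_den r
        rw [hq]; exact_mod_cast this.symm
      have h4 : x + j * α = t + m := by
        simp only [ht, hb, h3]; push_cast
        field_simp
        linear_combination h2
      rw [h4, hper]
    have htm : t ∈ Set.Icc (b i) (b (i+1+1)) := by
      have := hbs i
      have := hbs (i+1)
      have := abs_le.mp hd
      constructor <;> simp only [ht] <;> linarith
    rw [hFt]
    have hle : b (i+1) ≤ b (i+1+1) := hbm (Nat.le_succ _)
    have hI : F t - q * ∫ s in b (i + 1)..b (i + 1 + 1), F s =
        q * ∫ s in b (i + 1)..b (i + 1 + 1), (F t - F s) := by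
      rw [intervalIntegral.integral_sub (by simp) (hii _ _ (hlo _) hle (hhi _ (by omega)))]
      rw [intervalIntegral.integral_const, hbs, smul_eq_mul]
      field_simp
    rw [hI, abs_mul, Nat.abs_cast]
    have hn := intervalIntegral.norm_integral_le_of_norm_le_const (a := b (i+1)) (b := b (i+1+1))
      (f := fun s => F t - F s) (C := v (b (i+1+1)) - v (b i)) (by
        intro s hs
        rw [Set.uIoc_of_le hle] at hs
        rw [Real.norm_eq_abs]
        exact hosc _ _ _ _ (hlo _) (hhi _ (by omega)) htm
          ⟨(hbm (Nat.le_succ i)).trans hs.1.le, hs.2⟩)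
    rw [hbs, Real.norm_eq_abs, abs_of_pos (by positivity : (0:ℝ) < 1 / q)] at hn
    calc _ ≤ (q:ℝ) * ((v (b (i+1+1)) - v (b i)) * (1 / q)) :=
          mul_le_mul_of_nonneg_left hn hqR.le
      _ = _ := by field_simp
  have hsum0 : ∑ j ∈ range q, (q * ∫ s in b (σ j + 1)..b (σ j + 1 + 1), F s) = 0 := by
    rw [hreidx (fun i => q * ∫ s in b (i + 1)..b (i + 1 + 1), F s), ← Finset.mul_sum]
    rw [intervalIntegral.sum_integral_adjacent_intervals (a := fun i => b (i+1))]
    · simp only [zero_add]; rw [hb1, hbq, hint, mul_zero]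
    · intro k hk
      exact hii _ _ (hlo _) (hbm (Nat.le_succ _)) (hhi _ (by omega))
  have htel : ∑ j ∈ range q, (v (b (σ j + 1 + 1)) - v (b (σ j))) ≤ 2 * (v 2 - v (-1)) := by
    rw [hreidx (fun i => v (b (i+1+1)) - v (b i))]
    have : ∀ i, v (b (i+1+1)) - v (b i) =
      (v (b (i+1+1)) - v (b (i+1))) + (v (b (i+1)) - v (b i)) := fun i => by ring
    simp only [this]
    rw [Finset.sum_add_distrib, Finset.sum_range_sub (fun i => v (b i)),
      Finset.sum_range_sub (fun i => v (b (i+1)))]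
    have m2 : (2:ℝ) ∈ Set.Icc (-1:ℝ) 2 := by norm_num
    have m1 : (-1:ℝ) ∈ Set.Icc (-1:ℝ) 2 := by norm_num
    have A : ∀ i, i ≤ q + 1 → v (b i) ≤ v 2 := fun i hi =>
      hvm _ ⟨hlo i, hhi i hi⟩ _ m2 (hhi i hi)
    have B : ∀ i, i ≤ q + 1 → v (-1) ≤ v (b i) := fun i hi =>
      hvm _ m1 _ ⟨hlo i, hhi i hi⟩ (hlo i)
    have := A (q+1) le_rfl
    have := A q (by omega)
    have := B 0 (by omega)
    have := B (0+1) (by omega)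
    linarith
  have e : ∑ j ∈ range q, F (x + j * α) =
      ∑ j ∈ range q, (F (x + j * α) - q * ∫ s in b (σ j + 1)..b (σ j + 1 + 1), F s) := by
    rw [Finset.sum_sub_distrib, hsum0, sub_zero]
  rw [e]
  exact (Finset.abs_sum_le_sum_abs _ _).trans ((Finset.sum_le_sum hmain).trans htel)

lemma dk_circle (𝔣 : UnitAddCircle → ℝ)
    (hBV : BoundedVariationOn (fun t : ℝ => 𝔣 (t : UnitAddCircle)) (Set.Icc 0 1))
    (hmean : ∫ z : UnitAddCircle, 𝔣 z = 0) :
    ∃ C : ℝ, ∀ α : ℝ, Irrational α → ∀ N : ℕ, ∃ q : ℕ, N ≤ q ∧ 1 ≤ q ∧ ∀ y : UnitAddCircle,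
      |∑ j ∈ range q, 𝔣 (y + (((j : ℝ) * α : ℝ) : UnitAddCircle))| ≤ C := by
  set F : ℝ → ℝ := fun t : ℝ => 𝔣 (t : UnitAddCircle) with hF
  have hper1 : ∀ t, F (t + 1) = F t := by
    intro t; simp only [hF]; congr 1
    exact AddCircle.coe_add_period 1 t
  have hper : ∀ t, ∀ n : ℤ, F (t + n) = F t := by
    intro t n
    have : Function.Periodic F 1 := hper1
    simpa using this.int_mul n t
  obtain ⟨g, h, hg, hh, hgh⟩ :=
    (dk_bv F hper1 hBV).locallyBoundedVariationOn.exists_monotoneOn_sub_monotoneOn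
  refine ⟨2 * ((g 2 + h 2) - (g (-1) + h (-1))), fun α hα N => ?_⟩
  obtain ⟨r, hrN, hr⟩ := dk_den α hα N
  refine ⟨r.den, hrN, r.pos, fun y => ?_⟩
  obtain ⟨x, hx, rfl⟩ : ∃ x ∈ Set.Ico (0:ℝ) (0+1), (x : UnitAddCircle) = y := by
    have := AddCircle.coe_image_Ico_eq (p := (1:ℝ)) 0
    have hy : y ∈ (Set.univ : Set UnitAddCircle) := trivial
    rw [← this] at hy
    exact hy
  have := dk_core F g h hper hg hh hgh (fun t => by
    rw [← hmean]; exact UnitAddCircle.intervalIntegral_preimage t 𝔣) α r hr x hx.1 (by linarith [hx.2])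
  simpa [hF] using this

open scoped ENNReal

lemma walk_det (W : ℕ → ℤ → ℝ≥0∞) (P : ℤ → ℤ → ℝ≥0∞) (h : ℤ → ℝ≥0∞) (m : ℝ≥0∞)
    (hr : ∀ n k, k ≠ 0 → W (n+1) k = ∑' j, W n j * P j k)
    (hz : ∀ n, W (n+1) 0 = 0) (h0 : ∀ k, k ≠ 0 → W 0 k = 0) (h00 : W 0 0 ≤ 1)
    (ht : ∀ j, ∑' n, W n j * P j 0 ≤ 1)
    (hh0 : h 0 = 0) (hh : ∀ j, j ≠ 0 → ∑' k, P j k * h k = h j)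
    (hhf : ∑' k, P 0 k * h k ≠ ⊤)
    (hL : ∀ L : ℕ, ∃ R : ℕ, ∀ k : ℤ, (R:ℤ) < |k| → (L:ℝ≥0∞) ≤ h k)
    (hm : ∀ n, m ≤ ∑' k, W n k)
    (hP1 : ∀ j, P j (j-1) ≠ 0) (hP2 : ∀ j, P j (j+1) ≠ 0) : m = 0 := by
  -- energy
  set c := ∑' k, P 0 k * h k with hc
  have hE0 : ∀ n, ∑' k, W (n+1) k * h k = ∑' j, W n j * ∑' k, P j k * h k := by
    intro n
    have : ∀ k, W (n+1) k * h k = ∑' j, W n j * (P j k * h k) := by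
      intro k
      by_cases hk : k = 0
      · subst hk; simp [hh0]
      · rw [hr n k hk, ← ENNReal.tsum_mul_right]
        simp only [mul_assoc]
    simp only [this]
    rw [ENNReal.tsum_comm]
    simp only [ENNReal.tsum_mul_left]
  have hE : ∀ n, ∑' k, W (n+1) k * h k ≤ c := by
    intro n
    induction n with
    | zero =>
      rw [hE0, tsum_eq_single 0 (fun j hj => by simp [h0 j hj])]
      calc _ ≤ 1 * c := mul_le_mul_left h00 _
        _ = c := one_mul c
    | succ n ih =>
      rw [hE0]
      refine le_trans (le_of_eq ?_) ih
      apply tsum_congr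
      intro j
      by_cases hj : j = 0
      · subst hj; simp [hz]
      · rw [hh j hj]
  -- local summability
  have key : ∀ (a b : ℝ≥0∞), b ≠ 0 → a * b ≠ ⊤ → a ≠ ⊤ := by
    rintro a b hb hab rfl
    exact hab (ENNReal.top_mul hb)
  have hstep : ∀ j k, k ≠ 0 → P j k ≠ 0 → (∑' n, W n k ≠ ⊤) → ∑' n, W n j ≠ ⊤ := by
    intro j k hk hP hs
    apply key _ _ hP
    rw [← ENNReal.tsum_mul_right]
    refine ne_top_of_le_ne_top hs ?_
    calc ∑' n, W n j * P j k ≤ ∑' n, W (n+1) k := by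
          apply ENNReal.tsum_le_tsum
          intro n
          rw [hr n k hk]
          exact ENNReal.le_tsum (f := fun j => W n j * P j k) j
      _ ≤ ∑' n, W n k := ENNReal.tsum_comp_le_tsum_of_injective (add_left_injective 1) (fun n => W n k)
  have hbase : ∀ j, P j 0 ≠ 0 → ∑' n, W n j ≠ ⊤ := by
    intro j hP
    apply key _ _ hP
    rw [← ENNReal.tsum_mul_right]
    exact ne_top_of_le_ne_top ENNReal.one_ne_top (ht j)
  have hpos : ∀ n : ℕ, ∑' i, W i ((n:ℤ)+1) ≠ ⊤ := by
    intro n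
    induction n with
    | zero => apply hbase; simpa using hP1 1
    | succ n ih =>
      refine hstep _ ((n:ℤ)+1) (by omega) ?_ ih
      have := hP1 ((n:ℤ)+1+1)
      simpa using this
  have hneg : ∀ n : ℕ, ∑' i, W i (-((n:ℤ)+1)) ≠ ⊤ := by
    intro n
    induction n with
    | zero => apply hbase; simpa using hP2 (-1)
    | succ n ih =>
      refine hstep _ (-((n:ℤ)+1)) (by omega) ?_ ih
      have := hP2 (-((n:ℤ)+1+1))
      have e : -((n:ℤ)+1+1) + 1 = -((n:ℤ)+1) := by ring
      rw [e] at this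
      push_cast; exact this
  have hlim : ∀ k : ℤ, Tendsto (fun n => W (n+1) k) atTop (nhds 0) := by
    intro k
    by_cases hk : k = 0
    · subst hk; simp [hz]
    · have : ∑' n, W n k ≠ ⊤ := by
        rcases lt_or_gt_of_ne hk with h' | h'
        · obtain ⟨n, hn⟩ := Int.eq_ofNat_of_zero_le (show 0 ≤ -k - 1 by omega)
          have := hneg n
          rwa [show -((n:ℤ)+1) = k by omega] at this
        · obtain ⟨n, hn⟩ := Int.eq_ofNat_of_zero_le (show 0 ≤ k - 1 by omega)
          have := hpos n
          rwa [show ((n:ℤ)+1) = k by omega] at this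
      exact (tendsto_add_atTop_iff_nat 1).mpr (ENNReal.tendsto_atTop_zero_of_tsum_ne_top this)
  -- conclusion
  have hfin : ∀ L : ℕ, (L:ℝ≥0∞) * m ≤ c := by
    intro L
    obtain ⟨R, hR⟩ := hL L
    have hb : ∀ n, (L:ℝ≥0∞) * m ≤ c + L * ∑ k ∈ Finset.Icc (-(R:ℤ)) R, W (n+1) k := by
      intro n
      calc (L:ℝ≥0∞) * m ≤ L * ∑' k, W (n+1) k := mul_le_mul_right (hm _) _
        _ = ∑' k, L * W (n+1) k := ENNReal.tsum_mul_left.symm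
        _ ≤ ∑' k, (W (n+1) k * h k +
              if k ∈ Finset.Icc (-(R:ℤ)) R then L * W (n+1) k else 0) := by
            apply ENNReal.tsum_le_tsum
            intro k
            by_cases hk : k ∈ Finset.Icc (-(R:ℤ)) R
            · simp [hk]
            · rw [if_neg hk, add_zero, mul_comm]
              apply mul_le_mul_right
              apply hR
              by_contra! h'
              exact hk (Finset.mem_Icc.mpr (abs_le.mp h'))
        _ = ∑' k, W (n+1) k * h k +
              ∑' k, (if k ∈ Finset.Icc (-(R:ℤ)) R then L * W (n+1) k else 0) := ENNReal.tsum_add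
        _ ≤ c + L * ∑ k ∈ Finset.Icc (-(R:ℤ)) R, W (n+1) k := by
            apply add_le_add (hE n)
            rw [tsum_eq_sum (s := Finset.Icc (-(R:ℤ)) R) (fun k hk => if_neg hk), Finset.mul_sum]
            apply le_of_eq
            apply Finset.sum_congr rfl
            intro k hk
            rw [if_pos hk]
    have hl : Tendsto (fun n => c + L * ∑ k ∈ Finset.Icc (-(R:ℤ)) R, W (n+1) k) atTop
        (nhds (c + L * ∑ k ∈ Finset.Icc (-(R:ℤ)) R, 0)) := by
      apply Tendsto.add tendsto_const_nhds
      apply ENNReal.Tendsto.const_mul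
      · exact tendsto_finsetSum _ (fun k _ => hlim k)
      · right; exact ENNReal.natCast_ne_top L
    have := ge_of_tendsto' hl hb
    simpa using this
  by_contra hm0
  obtain ⟨n, hn⟩ := ENNReal.exists_nat_mul_gt hm0 hhf
  exact absurd (hfin n) (not_le.mpr hn)


lemma pOf_pos (𝔣 : UnitAddCircle → ℝ) (z) : 0 < pOf 𝔣 z := by unfold pOf; positivity

lemma one_sub_pOf (𝔣 : UnitAddCircle → ℝ) (z) : 1 - pOf 𝔣 z = 1 / (1 + Real.exp (𝔣 z)) := by
  unfold pOf
  have : 0 < 1 + Real.exp (𝔣 z) := by positivity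
  field_simp; ring

lemma pOf_lt (𝔣 : UnitAddCircle → ℝ) (z) : 0 < 1 - pOf 𝔣 z := by
  rw [one_sub_pOf]; positivity

lemma ratio1 (𝔣 : UnitAddCircle → ℝ) (z) : (1 - pOf 𝔣 z) / pOf 𝔣 z = Real.exp (-𝔣 z) := by
  rw [one_sub_pOf, Real.exp_neg]; unfold pOf
  have : 0 < 1 + Real.exp (𝔣 z) := by positivity
  have := Real.exp_pos (𝔣 z)
  field_simp

lemma ratio2 (𝔣 : UnitAddCircle → ℝ) (z) : pOf 𝔣 z / (1 - pOf 𝔣 z) = Real.exp (𝔣 z) := by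
  rw [one_sub_pOf]; unfold pOf
  have : 0 < 1 + Real.exp (𝔣 z) := by positivity
  field_simp

/-- forward increments of the harmonic function -/
def Dp (p : ℤ → ℝ) (i : ℕ) : ℝ := ∏ j ∈ Finset.range i, (1 - p ((j:ℤ)+1)) / p ((j:ℤ)+1)

/-- backward increments of the harmonic function -/
def Dm (p : ℤ → ℝ) (i : ℕ) : ℝ := ∏ j ∈ Finset.range (i+1), p (-(j:ℤ)) / (1 - p (-(j:ℤ)))

lemma diverge {X : Type} (a : ℕ → X → ℝ) (ha : ∀ i x, 0 ≤ a i x) (c : ℝ) (hc : 0 < c)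
    (hi : ∀ N, ∃ i ≥ N, ∀ x, c ≤ a i x) (A : ℝ) :
    ∃ n₀ : ℕ, ∀ x, ∀ n ≥ n₀, A < ∑ i ∈ range n, a i x := by
  have h1 : ∀ m : ℕ, ∃ n₀ : ℕ, ∀ x, (m:ℝ) * c ≤ ∑ i ∈ range n₀, a i x := by
    intro m
    induction m with
    | zero => exact ⟨0, fun x => by simp⟩
    | succ m ih =>
      obtain ⟨n₀, h⟩ := ih
      obtain ⟨i, hin, hia⟩ := hi n₀
      refine ⟨i+1, fun x => ?_⟩
      rw [Finset.sum_range_succ]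
      have h2 : ∑ i ∈ range n₀, a i x ≤ ∑ j ∈ range i, a j x :=
        Finset.sum_le_sum_of_subset_of_nonneg (Finset.range_mono hin) (fun j _ _ => ha j x)
      have := h x
      have := hia x
      push_cast; linarith
  obtain ⟨m, hm⟩ := exists_nat_gt (A / c)
  obtain ⟨n₀, h⟩ := h1 m
  refine ⟨n₀, fun x n hn => ?_⟩
  have h2 : ∑ i ∈ range n₀, a i x ≤ ∑ j ∈ range n, a j x :=
    Finset.sum_le_sum_of_subset_of_nonneg (Finset.range_mono hn) (fun j _ _ => ha j x)
  have := h x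
  rw [div_lt_iff₀ hc] at hm
  linarith

lemma Dp_pos (p : ℤ → ℝ) (h0 : ∀ k, 0 < p k) (h1 : ∀ k, 0 < 1 - p k) (i) : 0 < Dp p i :=
  Finset.prod_pos fun j _ => div_pos (h1 _) (h0 _)

lemma Dm_pos (p : ℤ → ℝ) (h0 : ∀ k, 0 < p k) (h1 : ∀ k, 0 < 1 - p k) (i) : 0 < Dm p i :=
  Finset.prod_pos fun j _ => div_pos (h0 _) (h1 _)

lemma div_both (α : ℝ) (hα : Irrational α) (𝔣 : UnitAddCircle → ℝ)
    (hBV : BoundedVariationOn (fun t : ℝ => 𝔣 (t : UnitAddCircle)) (Set.Icc 0 1))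
    (hmean : ∫ z : UnitAddCircle, 𝔣 z = 0) (A : ℝ) :
    ∃ n₀ : ℕ, ∀ x, ∀ n ≥ n₀, A < ∑ i ∈ range n, Dp (fun k => pOf 𝔣 (pt α x k)) i ∧
      A < ∑ i ∈ range n, Dm (fun k => pOf 𝔣 (pt α x k)) i := by
  obtain ⟨C, hC⟩ := dk_circle 𝔣 hBV hmean
  obtain ⟨n1, h1⟩ := diverge (fun i x => Dp (fun k => pOf 𝔣 (pt α x k)) i)
    (fun i x => (Dp_pos _ (fun _ => pOf_pos _ _) (fun _ => pOf_lt _ _) i).le) (Real.exp (-C))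
    (Real.exp_pos _) (by
      intro N
      obtain ⟨q, hq, -, hb⟩ := hC α hα N
      refine ⟨q, hq, fun x => ?_⟩
      simp only [Dp, ratio1]
      rw [← Real.exp_sum, Real.exp_le_exp, Finset.sum_neg_distrib]
      have := hb (x + (α : UnitAddCircle))
      have e : ∀ j : ℕ, pt α x ((j:ℤ)+1) =
          x + (α : UnitAddCircle) + (((j : ℝ) * α : ℝ) : UnitAddCircle) := by
        intro j; unfold pt
        rw [add_assoc, ← AddCircle.coe_add]; congr 2; push_cast; ring
      simp only [e]
      linarith [(abs_le.mp this).2]) A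
  obtain ⟨n2, h2⟩ := diverge (fun i x => Dm (fun k => pOf 𝔣 (pt α x k)) i)
    (fun i x => (Dm_pos _ (fun _ => pOf_pos _ _) (fun _ => pOf_lt _ _) i).le) (Real.exp (-C))
    (Real.exp_pos _) (by
      intro N
      obtain ⟨q, hq, hq1, hb⟩ := hC (-α) hα.neg (N+1)
      refine ⟨q-1, by omega, fun x => ?_⟩
      simp only [Dm, ratio2]
      rw [← Real.exp_sum, Real.exp_le_exp, Nat.sub_add_cancel hq1]
      have := hb x
      have e : ∀ j : ℕ, pt α x (-(j:ℤ)) = x + (((j : ℝ) * (-α) : ℝ) : UnitAddCircle) := by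
        intro j; unfold pt; congr 2; push_cast; ring
      simp only [e]
      linarith [(abs_le.mp this).1]) A
  exact ⟨max n1 n2, fun x n hn => ⟨h1 x n (le_trans (le_max_left _ _) hn),
    h2 x n (le_trans (le_max_right _ _) hn)⟩⟩

lemma Mfun_pos' (𝔭 : UnitAddCircle → ℝ) (α : ℝ) (x : UnitAddCircle) (n : ℕ) :
    Mfun 𝔭 α x ((n:ℤ)+1) = ∑ i ∈ range (n+1), Dp (fun k => 𝔭 (pt α x k)) i := by
  have e : ∀ k : ℕ, ∏ j ∈ Finset.Icc 1 k, (1 - 𝔭 (pt α x (j : ℤ))) / 𝔭 (pt α x (j : ℤ)) =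
      Dp (fun k => 𝔭 (pt α x k)) k := by
    intro k
    induction k with
    | zero => simp [Dp]
    | succ k ih =>
      rw [Finset.prod_Icc_succ_top (by omega), ih]
      unfold Dp
      rw [Finset.prod_range_succ]; push_cast; rfl
  unfold Mfun
  rw [if_pos (by omega)]
  simp only [e]
  have : ((n:ℤ)+1).toNat - 1 = n := by omega
  rw [this]
  induction n with
  | zero => simp [Dp]
  | succ n ih =>
    rw [Finset.sum_Icc_succ_top (by omega), Finset.sum_range_succ _ (n+1), ← ih (by omega)]
    ring

lemma Mfun_neg' (𝔭 : UnitAddCircle → ℝ) (α : ℝ) (x : UnitAddCircle) (n : ℕ) :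
    Mfun 𝔭 α x (-((n:ℤ)+1)) = -∑ i ∈ range (n+2), Dm (fun k => 𝔭 (pt α x k)) i := by
  unfold Mfun
  rw [if_neg (by omega), if_neg (by omega)]
  have : (-(-((n:ℤ)+1))).toNat + 1 = n + 2 := by omega
  rw [this]; rfl

/-- nonnegative function, harmonic off the origin -/
def Hf (p : ℤ → ℝ) : ℤ → ℝ
  | Int.ofNat n => ∑ i ∈ range n, Dp p i
  | Int.negSucc n => ∑ i ∈ range (n+1), Dm p i

lemma Hf_nat (p : ℤ → ℝ) (n : ℕ) : Hf p n = ∑ i ∈ range n, Dp p i := rfl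

lemma Hf_neg (p : ℤ → ℝ) (n : ℕ) : Hf p (-(n:ℤ)) = ∑ i ∈ range n, Dm p i := by
  cases n with
  | zero => rfl
  | succ n => rfl

lemma Hf_nonneg (p : ℤ → ℝ) (h0 : ∀ k, 0 < p k) (h1 : ∀ k, 0 < 1 - p k) (k : ℤ) :
    0 ≤ Hf p k := by
  cases k with
  | ofNat n => exact Finset.sum_nonneg fun i _ => (Dp_pos p h0 h1 i).le
  | negSucc n => exact Finset.sum_nonneg fun i _ => (Dm_pos p h0 h1 i).le

lemma Hf_harm (p : ℤ → ℝ) (h0 : ∀ k, 0 < p k) (h1 : ∀ k, 0 < 1 - p k) (k : ℤ) (hk : k ≠ 0) :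
    p k * Hf p (k+1) + (1 - p k) * Hf p (k-1) = Hf p k := by
  rcases lt_or_gt_of_ne hk with h' | h'
  · obtain ⟨n, hn⟩ := Int.eq_ofNat_of_zero_le (show 0 ≤ -k - 1 by omega)
    obtain rfl : k = -((n+1:ℕ):ℤ) := by push_cast; omega
    rw [show -((n+1:ℕ):ℤ) + 1 = -((n:ℕ):ℤ) by push_cast; ring,
      show -((n+1:ℕ):ℤ) - 1 = -((n+1+1:ℕ):ℤ) by push_cast; ring, Hf_neg, Hf_neg, Hf_neg,
      Finset.sum_range_succ _ (n+1), Finset.sum_range_succ _ n]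
    have e : Dm p (n+1) = Dm p n * (p (-((n+1:ℕ):ℤ)) / (1 - p (-((n+1:ℕ):ℤ)))) :=
      Finset.prod_range_succ _ _
    rw [e]
    have := h1 (-((n+1:ℕ):ℤ))
    generalize p (-((n+1:ℕ):ℤ)) = y at *
    field_simp
    ring
  · obtain ⟨n, hn⟩ := Int.eq_ofNat_of_zero_le (show 0 ≤ k - 1 by omega)
    obtain rfl : k = ((n+1:ℕ):ℤ) := by push_cast; omega
    rw [show ((n+1:ℕ):ℤ) - 1 = ((n:ℕ):ℤ) by push_cast; ring,
      show ((n+1:ℕ):ℤ) + 1 = ((n+1+1:ℕ):ℤ) by push_cast; ring, Hf_nat, Hf_nat, Hf_nat,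
      Finset.sum_range_succ _ (n+1), Finset.sum_range_succ _ n]
    have e : Dp p (n+1) = Dp p n * ((1 - p ((n+1:ℕ):ℤ)) / p ((n+1:ℕ):ℤ)) := by
      unfold Dp; rw [Finset.prod_range_succ]; push_cast; rfl
    rw [e]
    have := h0 ((n+1:ℕ):ℤ)
    generalize p ((n+1:ℕ):ℤ) = y at *
    field_simp
    ring

section walk
variable {𝔭 : UnitAddCircle → ℝ} {α : ℝ} {x : UnitAddCircle} {Ω : Type} [MeasurableSpace Ω]
  {ℙ : Measure Ω} {ξ : ℕ → Ω → ℤ}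

lemma stepProb_nonneg (h0 : ∀ z, 0 < 𝔭 z) (h1 : ∀ z, 0 < 1 - 𝔭 z) (j k : ℤ) :
    0 ≤ stepProb 𝔭 α x j k := by
  unfold stepProb
  split_ifs
  · exact (h0 _).le
  · exact (h1 _).le
  · exact le_rfl

lemma walk_markov (h0 : ∀ z, 0 < 𝔭 z) (h1 : ∀ z, 0 < 1 - 𝔭 z)
    (hw : IsQPWalk 𝔭 α x 0 ℙ ξ) (n : ℕ) (j k : ℤ) (S : Set (Fin (n+1) → ℤ)) :
    ℙ ({ω | (fun i : Fin (n+1) => ξ i ω) ∈ S} ∩ ({ω | ξ n ω = j} ∩ {ω | ξ (n+1) ω = k})) =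
      ℙ ({ω | (fun i : Fin (n+1) => ξ i ω) ∈ S} ∩ {ω | ξ n ω = j}) *
        ENNReal.ofReal (stepProb 𝔭 α x j k) := by
  obtain ⟨hp, hmeas, hfd⟩ := hw
  set Φ : Ω → (Fin (n+1) → ℤ) := fun ω i => ξ i ω with hΦ
  have hΦm : Measurable Φ := measurable_pi_lambda _ (fun i => hmeas i)
  have hmk : ∀ i k, MeasurableSet {ω | ξ i ω = k} := fun i k =>
    hmeas i (measurableSet_singleton k)
  have key : (ℙ.restrict ({ω | ξ n ω = j} ∩ {ω | ξ (n+1) ω = k})).map Φ =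
      ENNReal.ofReal (stepProb 𝔭 α x j k) • (ℙ.restrict {ω | ξ n ω = j}).map Φ := by
    apply Measure.ext_of_singleton
    intro s
    rw [Measure.smul_apply, Measure.map_apply hΦm (measurableSet_singleton _),
      Measure.map_apply hΦm (measurableSet_singleton _),
      Measure.restrict_apply (hΦm (measurableSet_singleton _)),
      Measure.restrict_apply (hΦm (measurableSet_singleton _)), smul_eq_mul]
    by_cases hs : s (Fin.last n) = j
    · set κ : ℕ → ℤ := fun i => if hi : i < n + 1 then s ⟨i, hi⟩ else k with hκ
      have hκn : κ n = j := by simp only [hκ]; rw [dif_pos (by omega)]; exact hs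
      have hκn1 : κ (n+1) = k := by simp [hκ]
      have e2 : Φ ⁻¹' {s} ∩ {ω | ξ n ω = j} = {ω | ∀ i ≤ n, ξ i ω = κ i} := by
        ext ω
        simp only [Set.mem_inter_iff, Set.mem_preimage, Set.mem_singleton_iff, Set.mem_setOf_eq]
        constructor
        · rintro ⟨hh, -⟩ i hi
          simp only [hκ]; rw [dif_pos (by omega), ← hh]
        · intro hh
          refine ⟨?_, by rw [hh n le_rfl, hκn]⟩
          funext i
          have := hh i (by omega)
          simp only [hκ] at this
          rw [dif_pos i.2] at this
          exact this
      have e1 : Φ ⁻¹' {s} ∩ ({ω | ξ n ω = j} ∩ {ω | ξ (n+1) ω = k}) =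
          {ω | ∀ i ≤ n+1, ξ i ω = κ i} := by
        rw [← Set.inter_assoc, e2]
        ext ω
        simp only [Set.mem_inter_iff, Set.mem_setOf_eq]
        constructor
        · rintro ⟨hh, h2⟩ i hi
          rcases Nat.lt_or_ge n i with h3 | h3
          · obtain rfl : i = n+1 := by omega
            rw [h2, hκn1]
          · exact hh i h3
        · intro hh
          exact ⟨fun i hi => hh i (by omega), by rw [hh _ le_rfl, hκn1]⟩
      rw [e1, e2, hfd, hfd, Finset.prod_range_succ, ← mul_assoc, ENNReal.ofReal_mul, hκn, hκn1,
        mul_comm]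
      apply mul_nonneg
      · split_ifs <;> norm_num
      · exact Finset.prod_nonneg fun i _ => stepProb_nonneg h0 h1 _ _
    · have e : Φ ⁻¹' {s} ∩ {ω | ξ n ω = j} = ∅ := by
        ext ω
        simp only [Set.mem_inter_iff, Set.mem_preimage, Set.mem_singleton_iff, Set.mem_setOf_eq,
          Set.mem_empty_iff_false, iff_false, not_and]
        intro hh h2
        apply hs
        rw [← hh, ← h2]; simp [hΦ]
      rw [← Set.inter_assoc, e]
      simp
  have hS : MeasurableSet S := S.to_countable.measurableSet
  have := congrArg (fun μ => μ S) key
  simp only [Measure.smul_apply] at this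
  rw [Measure.map_apply hΦm hS, Measure.map_apply hΦm hS, Measure.restrict_apply (hΦm hS),
    Measure.restrict_apply (hΦm hS), smul_eq_mul, mul_comm] at this
  exact this

lemma tsum_step (h0 : ∀ z, 0 < 𝔭 z) (h1 : ∀ z, 0 < 1 - 𝔭 z) (j : ℤ) (H : ℤ → ℝ)
    (hH : ∀ k, 0 ≤ H k) :
    ∑' k, ENNReal.ofReal (stepProb 𝔭 α x j k) * ENNReal.ofReal (H k) =
      ENNReal.ofReal (𝔭 (pt α x j) * H (j+1) + (1 - 𝔭 (pt α x j)) * H (j-1)) := by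
  rw [tsum_eq_sum (s := {j+1, j-1})]
  · rw [Finset.sum_pair (by omega)]
    rw [← ENNReal.ofReal_mul (stepProb_nonneg h0 h1 _ _),
      ← ENNReal.ofReal_mul (stepProb_nonneg h0 h1 _ _), ← ENNReal.ofReal_add]
    · unfold stepProb
      rw [if_pos rfl, if_neg (by omega), if_pos rfl]
    · exact mul_nonneg (stepProb_nonneg h0 h1 _ _) (hH _)
    · exact mul_nonneg (stepProb_nonneg h0 h1 _ _) (hH _)
  · intro k hk
    simp only [Finset.mem_insert, Finset.mem_singleton, not_or] at hk
    unfold stepProb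
    rw [if_neg hk.1, if_neg hk.2]; simp

lemma walk_rec (h0 : ∀ z, 0 < 𝔭 z) (h1 : ∀ z, 0 < 1 - 𝔭 z)
    (hw : IsQPWalk 𝔭 α x 0 ℙ ξ)
    (hL : ∀ L : ℝ, ∃ n₀ : ℕ, ∀ n ≥ n₀, L < ∑ i ∈ range n, Dp (fun k => 𝔭 (pt α x k)) i ∧
      L < ∑ i ∈ range n, Dm (fun k => 𝔭 (pt α x k)) i) :
    ℙ {ω | ∃ n : ℕ, 1 ≤ n ∧ ξ n ω = 0} = 1 := by
  have hp : IsProbabilityMeasure ℙ := hw.1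
  have hmeas := hw.2.1
  have hmk : ∀ i k, MeasurableSet {ω | ξ i ω = k} := fun i k =>
    hmeas i (measurableSet_singleton k)
  set p : ℤ → ℝ := fun k => 𝔭 (pt α x k) with hpdef
  set B : ∀ n : ℕ, Set (Fin (n+1) → ℤ) := fun n => {s | ∀ i : Fin (n+1), 1 ≤ (i:ℕ) → s i ≠ 0} with hB
  set A : ℕ → Set Ω := fun n => {ω | (fun i : Fin (n+1) => ξ i ω) ∈ B n} with hA
  have hAmem : ∀ n ω, ω ∈ A n ↔ ∀ i, 1 ≤ i → i ≤ n → ξ i ω ≠ 0 := by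
    intro n ω
    constructor
    · intro h i hi hin
      exact h ⟨i, by omega⟩ hi
    · intro h i hi
      exact h i hi (by omega)
  have hAm : ∀ n, MeasurableSet (A n) := fun n =>
    (measurable_pi_lambda (fun ω (i : Fin (n+1)) => ξ i ω) (fun i => hmeas i))
      (B n).to_countable.measurableSet
  have hmark : ∀ n j k, ℙ (A n ∩ ({ω | ξ n ω = j} ∩ {ω | ξ (n+1) ω = k})) =
      ℙ (A n ∩ {ω | ξ n ω = j}) * ENNReal.ofReal (stepProb 𝔭 α x j k) :=
    fun n j k => walk_markov h0 h1 hw n j k (B n)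
  have hdec : ∀ (n : ℕ) (T : Set Ω), MeasurableSet T →
      ℙ T = ∑' j, ℙ (T ∩ {ω | ξ n ω = j}) := by
    intro n T hT
    rw [← measure_iUnion]
    · congr 1
      ext ω; simp
    · intro a b hab
      rw [Function.onFun, Set.disjoint_left]
      rintro ω ⟨-, h1⟩ ⟨-, h2⟩
      exact hab (h1.symm.trans h2)
    · exact fun j => hT.inter (hmk n j)
  set R : Set Ω := {ω | ∃ n : ℕ, 1 ≤ n ∧ ξ n ω = 0} with hR
  have hRm : MeasurableSet R := by
    have : R = ⋃ n : ℕ, ⋃ _ : 1 ≤ n, {ω | ξ n ω = 0} := by ext ω; simp [hR]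
    rw [this]
    exact MeasurableSet.iUnion fun n => MeasurableSet.iUnion fun _ => hmk n 0
  have hzero : ℙ Rᶜ = 0 := by
    apply walk_det (fun n k => ℙ (A n ∩ {ω | ξ n ω = k}))
      (fun j k => ENNReal.ofReal (stepProb 𝔭 α x j k)) (fun k => ENNReal.ofReal (Hf p k))
    · intro n k hk
      have e : A (n+1) ∩ {ω | ξ (n+1) ω = k} = A n ∩ {ω | ξ (n+1) ω = k} := by
        ext ω
        simp only [Set.mem_inter_iff, hAmem, Set.mem_setOf_eq]
        constructor
        · rintro ⟨h, h2⟩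
          exact ⟨fun i hi hin => h i hi (by omega), h2⟩
        · rintro ⟨h, h2⟩
          refine ⟨fun i hi hin => ?_, h2⟩
          rcases Nat.lt_or_ge n i with h3 | h3
          · obtain rfl : i = n+1 := by omega
            rw [h2]; exact hk
          · exact h i hi h3
      simp only [e]
      rw [hdec n _ ((hAm n).inter (hmk _ _))]
      apply tsum_congr
      intro j
      rw [← hmark]
      congr 1
      ext ω; simp only [Set.mem_inter_iff]; tauto
    · intro n
      have e : A (n+1) ∩ {ω | ξ (n+1) ω = 0} = ∅ := by
        ext ω
        simp only [Set.mem_inter_iff, hAmem, Set.mem_setOf_eq, Set.mem_empty_iff_false, iff_false,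
          not_and]
        intro h
        exact h (n+1) (by omega) le_rfl
      simp [e]
    · intro k hk
      have := hw.2.2 0 (fun _ => k)
      simp only [if_neg hk, zero_mul, ENNReal.ofReal_zero] at this
      refine measure_mono_null ?_ this
      rintro ω ⟨-, h⟩ i hi
      obtain rfl : i = 0 := by omega
      exact h
    · exact prob_le_one
    · intro j
      simp only [← hmark]
      rw [← measure_iUnion]
      · exact prob_le_one
      · intro a b hab
        rw [Function.onFun, Set.disjoint_left]
        rintro ω ⟨ha, -, ha'⟩ ⟨hb, -, hb'⟩
        rw [hAmem] at ha hb
        rcases lt_or_gt_of_ne hab with h | h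
        · exact hb (a+1) (by omega) (by omega) ha'
        · exact ha (b+1) (by omega) (by omega) hb'
      · exact fun n => (hAm n).inter ((hmk _ _).inter (hmk _ _))
    · simp [show Hf p 0 = 0 from rfl]
    · intro j hj
      rw [tsum_step h0 h1 j (Hf p) (Hf_nonneg p (fun _ => h0 _) (fun _ => h1 _))]
      congr 1
      exact Hf_harm p (fun _ => h0 _) (fun _ => h1 _) j hj
    · rw [tsum_step h0 h1 0 (Hf p) (Hf_nonneg p (fun _ => h0 _) (fun _ => h1 _))]
      exact ENNReal.ofReal_ne_top
    · intro L
      obtain ⟨n₀, h⟩ := hL L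
      refine ⟨n₀, fun k hk => ?_⟩
      have hle : (L:ℝ) ≤ Hf p k := by
        rcases le_or_gt 0 k with h' | h'
        · obtain ⟨n, rfl⟩ := Int.eq_ofNat_of_zero_le h'
          rw [abs_of_nonneg h'] at hk
          rw [Hf_nat]; exact (h n (by omega)).1.le
        · obtain ⟨n, hn⟩ := Int.eq_ofNat_of_zero_le (show 0 ≤ -k by omega)
          rw [abs_of_neg h'] at hk
          obtain rfl : k = -(n:ℤ) := by omega
          rw [Hf_neg]; exact (h n (by omega)).2.le
      rw [← ENNReal.ofReal_natCast]
      exact ENNReal.ofReal_le_ofReal hle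
    · intro n
      rw [← hdec n _ (hAm n)]
      apply measure_mono
      intro ω hω
      rw [hAmem]
      intro i hi _ h
      exact hω ⟨i, hi, h⟩
    · intro j
      unfold stepProb
      rw [if_neg (by omega), if_pos rfl]
      exact (ENNReal.ofReal_pos.mpr (h1 _)).ne'
    · intro j
      unfold stepProb
      rw [if_pos rfl]
      exact (ENNReal.ofReal_pos.mpr (h0 _)).ne'
  exact (prob_compl_eq_zero_iff hRm).mp hzero

end walk

/-- Lemma 2.1: if `𝔣` is of bounded variation with `∫_𝕋 𝔣 = 0` and
`𝔭 = e^𝔣/(1+e^𝔣)`, then `M(n) → +∞` as `n → +∞` and `M(n) → -∞` as `n → -∞`, uniformly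
in `x ∈ 𝕋`; consequently the random walk `(ξ_n)` in the environment `(𝔭, α, x)` is
recurrent: it returns to `0` almost surely. -/
theorem statement5 (α : ℝ) (hα : Irrational α) (𝔣 : UnitAddCircle → ℝ)
    (hBV : BoundedVariationOn (fun t : ℝ => 𝔣 (t : UnitAddCircle)) (Set.Icc 0 1))
    (hmean : ∫ z : UnitAddCircle, 𝔣 z = 0) :
    (∀ A : ℝ, 0 < A → ∃ n₀ : ℕ, ∀ x : UnitAddCircle,
      (∀ n : ℤ, (n₀ : ℤ) ≤ n → A < Mfun (pOf 𝔣) α x n) ∧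
      (∀ n : ℤ, n ≤ -(n₀ : ℤ) → Mfun (pOf 𝔣) α x n < -A)) ∧
    ∀ (x : UnitAddCircle) (Ω : Type) [MeasurableSpace Ω] (ℙ : Measure Ω)
      (ξ : ℕ → Ω → ℤ), IsQPWalk (pOf 𝔣) α x 0 ℙ ξ →
      ℙ {ω | ∃ n : ℕ, 1 ≤ n ∧ ξ n ω = 0} = 1 := by
  constructor
  · intro A _
    obtain ⟨n₀, h⟩ := div_both α hα 𝔣 hBV hmean A
    refine ⟨n₀ + 1, fun x => ⟨fun n hn => ?_, fun n hn => ?_⟩⟩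
    · obtain ⟨m, hm⟩ := Int.eq_ofNat_of_zero_le (show 0 ≤ n - 1 by omega)
      obtain rfl : n = (m:ℤ) + 1 := by omega
      rw [Mfun_pos']
      exact (h x _ (by omega)).1
    · obtain ⟨m, hm⟩ := Int.eq_ofNat_of_zero_le (show 0 ≤ -n - 1 by omega)
      obtain rfl : n = -((m:ℤ) + 1) := by omega
      rw [Mfun_neg', neg_lt_neg_iff]
      exact (h x _ (by omega)).2
  · intro x Ω _ ℙ ξ hw
    apply walk_rec (fun z => pOf_pos 𝔣 z) (fun z => pOf_lt 𝔣 z) hw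
    intro L
    obtain ⟨n₀, h⟩ := div_both α hα 𝔣 hBV hmean L
    exact ⟨n₀, fun n hn => h x n hn⟩
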